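/- Let F be a positive integer and S ∈ Sat(F). Then X₀ = {x ∈ S\{0} : x < F and d_S(x) ≠ d_S(y) for every y ∈ S\{0} with y < x} is the unique minimal Sat(F)-system of generators of S; that is, Sat(F)[X₀] = S, and every set X with Sat(F)[X] = S satisfies X₀ ⊆ X. -/

import Mathlib

/-- A numerical semigroup: subset of ℕ containing 0, closed under addition,
with finite complement. -/
def IsNumericalSemigroup (S : Set ℕ) : Prop :=
  0 ∈ S ∧ (∀ a ∈ S, ∀ b ∈ S, a + b ∈ S) ∧ Sᶜ.Finite

/-- `dOf S s = gcd {x ∈ S : x ≤ s}`. -/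
noncomputable def dOf (S : Set ℕ) (s : ℕ) : ℕ :=
  letI := Classical.decPred (· ∈ S)
  ((Finset.range (s + 1)).filter (· ∈ S)).gcd id

/-- A saturated numerical semigroup. -/
def IsSaturatedNS (S : Set ℕ) : Prop :=
  IsNumericalSemigroup S ∧ ∀ s ∈ S, s ≠ 0 → s + dOf S s ∈ S

/-- `Sat F`: saturated numerical semigroups with Frobenius number `F`. -/
def SatF (F : ℕ) : Set (Set ℕ) :=
  {S | IsSaturatedNS S ∧ F ∉ S ∧ ∀ x, x ∉ S → x ≤ F}

/-- Multiplicity: least nonzero element. -/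
noncomputable def multOf (S : Set ℕ) : ℕ := sInf {x | x ∈ S ∧ x ≠ 0}

/-- Pseudo-Frobenius numbers. -/
def PFset (S : Set ℕ) : Set ℕ := {z | z ∉ S ∧ ∀ s ∈ S, s ≠ 0 → z + s ∈ S}

/-- Special gaps. -/
def SGset (S : Set ℕ) : Set ℕ := {x | x ∈ PFset S ∧ 2 * x ∈ S}

/-- `TSet a b = ⟨a⟩ ∪ {x : x ≥ b}`. -/
def TSet (a b : ℕ) : Set ℕ := {x | a ∣ x} ∪ {x | b ≤ x}

/-- A `Sat(F)`-set. -/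
def SatFSet (F : ℕ) (X : Set ℕ) : Prop :=
  X ∩ ({0} ∪ {x | F + 1 ≤ x}) = ∅ ∧ ∃ S ∈ SatF F, X ⊆ S

/-- `Sat(F)[X]`: intersection of all elements of `Sat F` containing `X`. -/
def SatClosure (F : ℕ) (X : Set ℕ) : Set ℕ := ⋂₀ {S | S ∈ SatF F ∧ X ⊆ S}

/-- `X` is a minimal `Sat(F)`-system of generators of `S`. -/
def IsMinSatGen (F : ℕ) (X S : Set ℕ) : Prop :=
  SatFSet F X ∧ SatClosure F X = S ∧ ∀ Y : Set ℕ, Y ⊂ X → SatClosure F Y ≠ S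

/-- The `Sat(F)`-rank of `S`: minimal cardinality of a `Sat(F)`-set `X`
with `Sat(F)[X] = S`. -/
noncomputable def SatRank (F : ℕ) (S : Set ℕ) : ℕ :=
  sInf {k | ∃ X : Set ℕ, SatFSet F X ∧ SatClosure F X = S ∧ X.ncard = k}

theorem dvd_dOf_iff {S : Set ℕ} {s d : ℕ} : d ∣ dOf S s ↔ ∀ x ∈ S, x ≤ s → d ∣ x := by
  classical
  simp only [dOf, Finset.dvd_gcd_iff, Finset.mem_filter, Finset.mem_range, id]
  exact ⟨fun h x hx hxs => h x ⟨by omega, hx⟩, fun h x hx => h x hx.2 (by omega)⟩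

theorem dOf_dvd {S : Set ℕ} {s x : ℕ} (hx : x ∈ S) (hxs : x ≤ s) : dOf S s ∣ x :=
  dvd_dOf_iff.1 dvd_rfl x hx hxs

theorem dOf_dvd_dOf {S T : Set ℕ} {s t : ℕ} (h : ∀ x ∈ S, x ≤ s → x ∈ T ∧ x ≤ t) :
    dOf T t ∣ dOf S s :=
  dvd_dOf_iff.2 fun x hx hxs => dOf_dvd (h x hx hxs).1 (h x hx hxs).2

theorem dOf_pos {S : Set ℕ} {s : ℕ} (hs : s ∈ S) (h0 : s ≠ 0) : 0 < dOf S s :=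
  Nat.pos_of_dvd_of_pos (dOf_dvd hs le_rfl) (Nat.pos_of_ne_zero h0)

/-- In a saturated numerical semigroup, every multiple of `dOf S s` that is at least `s`
belongs to `S`. -/
theorem IsSaturatedNS.mem_of_dOf_dvd {S : Set ℕ} (hS : IsSaturatedNS S) {s n : ℕ}
    (hs : s ∈ S) (h0 : s ≠ 0) (hsn : s ≤ n) (hd : dOf S s ∣ n) : n ∈ S := by
  induction hk : n - s using Nat.strong_induction_on generalizing s with
  | _ k ih =>
    obtain rfl | hlt := hsn.eq_or_lt
    · exact hs
    have hpos := dOf_pos hs h0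
    have hle : dOf S s ≤ n - s :=
      Nat.le_of_dvd (by omega) (Nat.dvd_sub hd (dOf_dvd hs le_rfl))
    have hdvd : dOf S (s + dOf S s) ∣ dOf S s :=
      dOf_dvd_dOf fun x hx hxs => ⟨hx, by omega⟩
    exact ih (n - (s + dOf S s)) (by omega) (hS.2 s hs h0) (by omega) (by omega)
      (hdvd.trans hd) rfl

/-- If `dOf S` takes a new value at `x`, then no nonzero `s < x` in `S` satisfies
`dOf S (x - 1) ∣ x`. -/
theorem not_dOf_pred_dvd {S : Set ℕ} {x s : ℕ}
    (hx : ∀ y ∈ S, y ≠ 0 → y < x → dOf S x ≠ dOf S y)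
    (hs : s ∈ S) (h0 : s ≠ 0) (hsx : s < x) : ¬ dOf S (x - 1) ∣ x := by
  classical
  intro hd
  obtain ⟨y, hy, hmax⟩ := ((Finset.range x).filter (· ∈ S)).exists_max_image id
    ⟨s, by simp [hs, hsx]⟩
  simp only [Finset.mem_filter, Finset.mem_range, id, and_imp] at hy hmax
  have hsy := hmax s hsx hs
  refine hx y hy.2 (by omega) hy.1 (Nat.dvd_antisymm ?_ ?_)
  · exact dOf_dvd_dOf fun z hz hzy => ⟨hz, by omega⟩
  · refine dvd_dOf_iff.2 fun z hz hzx => ?_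
    obtain rfl | hlt := hzx.eq_or_lt
    · exact (dOf_dvd_dOf fun w hw hwx => ⟨hw, hmax w (by omega) hw⟩ :
        dOf S y ∣ dOf S (z - 1)).trans hd
    · exact dOf_dvd hz (hmax z hlt hz)

/-- Removing from `S ∈ SatF F` an element `x < F` at which `dOf S` takes a new value gives
an element of `SatF F`. -/
theorem diff_singleton_mem_SatF {F : ℕ} {S : Set ℕ} (hS : S ∈ SatF F) {x : ℕ}
    (h0 : x ≠ 0) (hxF : x < F) (hx : ∀ y ∈ S, y ≠ 0 → y < x → dOf S x ≠ dOf S y) :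
    S \ {x} ∈ SatF F := by
  obtain ⟨hsat, hF, hgt⟩ := hS
  obtain ⟨⟨hzero, hadd, hfin⟩, -⟩ := id hsat
  refine ⟨⟨⟨⟨hzero, h0.symm⟩, ?_, ?_⟩, ?_⟩, fun h => hF h.1, ?_⟩
  · rintro a ⟨ha, hax⟩ b ⟨hb, hbx⟩
    refine ⟨hadd a ha b hb, fun hab => ?_⟩
    simp only [Set.mem_singleton_iff] at hax hbx hab
    refine not_dOf_pred_dvd hx ha (by omega) (by omega) ?_
    have h := dvd_add (dOf_dvd (s := x - 1) ha (by omega)) (dOf_dvd (s := x - 1) hb (by omega))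
    rwa [hab] at h
  · rw [Set.sdiff_eq, Set.compl_inter, compl_compl]
    exact hfin.union (Set.finite_singleton x)
  · rintro s ⟨hs, hsx⟩ hs0
    simp only [Set.mem_singleton_iff] at hsx
    have hdvd : dOf S s ∣ dOf (S \ {x}) s := dOf_dvd_dOf fun z hz hzs => ⟨hz.1, hzs⟩
    have hmem : s + dOf (S \ {x}) s ∈ S :=
      hsat.mem_of_dOf_dvd hs hs0 (by omega) (dvd_add (dOf_dvd hs le_rfl) hdvd)
    refine ⟨hmem, fun heq => ?_⟩
    simp only [Set.mem_singleton_iff] at heq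
    have hlt : s < x := by omega
    refine not_dOf_pred_dvd hx hs hs0 hlt ?_
    have h : dOf S (x - 1) ∣ dOf (S \ {x}) s :=
      dOf_dvd_dOf fun z hz hzs => ⟨hz.1, by omega⟩
    have h' := dvd_add (dOf_dvd (s := x - 1) hs (by omega)) h
    rwa [heq] at h'
  · intro z hz
    by_cases hzx : z = x
    · omega
    · exact hgt z fun h => hz ⟨h, hzx⟩

/-- An element of `SatF F` containing every element of `S` below `F` at which `dOf S` takes a
new value contains `S`. -/
theorem subset_of_new_dOf_subset {F : ℕ} {S T : Set ℕ} (hS : S ∈ SatF F) (hT : T ∈ SatF F)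
    (h : {x | x ∈ S ∧ x ≠ 0 ∧ x < F ∧
      ∀ y ∈ S, y ≠ 0 → y < x → dOf S x ≠ dOf S y} ⊆ T) : S ⊆ T := by
  intro x
  induction x using Nat.strong_induction_on with
  | _ x ih =>
    intro hx
    by_cases h0 : x = 0
    · exact h0 ▸ hT.1.1.1
    by_cases hxF : F < x
    · by_contra hxT
      exact absurd (hT.2.2 x hxT) (by omega)
    have hne : x ≠ F := fun he => hS.2.1 (he ▸ hx)
    by_cases hnew : ∀ y ∈ S, y ≠ 0 → y < x → dOf S x ≠ dOf S y
    · exact h ⟨hx, h0, by omega, hnew⟩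
    push Not at hnew
    obtain ⟨y, hy, hy0, hyx, hd⟩ := hnew
    refine hT.1.mem_of_dOf_dvd (ih y hyx hy) hy0 hyx.le ?_
    have hdvd : dOf T y ∣ dOf S y :=
      dOf_dvd_dOf fun z hz hzy => ⟨ih z (by omega) hz, hzy⟩
    exact hdvd.trans (hd ▸ dOf_dvd hx le_rfl)


/-- the set `X₀` is the unique minimal `Sat(F)`-system of
generators of `S`: it generates `S` and is contained in every `Sat(F)`-set
generating `S`. -/
theorem unique_minimal_SatF_generators (F : ℕ) (hF : 0 < F)
    (S : Set ℕ) (hS : S ∈ SatF F) :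
    SatClosure F
        {x | x ∈ S ∧ x ≠ 0 ∧ x < F ∧
          ∀ y ∈ S, y ≠ 0 → y < x → dOf S x ≠ dOf S y} = S ∧
      ∀ X : Set ℕ, SatFSet F X → SatClosure F X = S →
        {x | x ∈ S ∧ x ≠ 0 ∧ x < F ∧
          ∀ y ∈ S, y ≠ 0 → y < x → dOf S x ≠ dOf S y} ⊆ X := by
  refine ⟨Set.Subset.antisymm (Set.sInter_subset_of_mem ⟨hS, fun x hx => hx.1⟩)
    (Set.subset_sInter fun T hT => subset_of_new_dOf_subset hS hT.1 hT.2), ?_⟩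
  rintro X - hX x ⟨hxS, h0, hxF, hx⟩
  by_contra hxX
  have hXS : X ⊆ S := hX ▸ Set.subset_sInter fun T hT => hT.2
  have hsub : SatClosure F X ⊆ S \ {x} := Set.sInter_subset_of_mem
    ⟨diff_singleton_mem_SatF hS h0 hxF hx, Set.subset_sdiff_singleton hXS hxX⟩
  rw [hX] at hsub
  exact (hsub hxS).2 rfl
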